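/- arXiv:1608.06198 — 7 statements merged into one kernel-verified Lean document; each statement's English description precedes it below -/
import Mathlib

section
/- Let F : (Fin m → ℝ) × (Fin d → ℝ) → ℝ be a C^∞ function (d,m ≥ 1) and let c ∈ ℝ. Assume the family is transverse to the level set at value c, i.e. for every point z = (x,s) with F z = c the total Fréchet derivative satisfies fderiv ℝ F z ≠ 0. Then for Lebesgue-almost every s ∈ (Fin d → ℝ), the slice map x ↦ F (x,s) has no critical point on its level set at value c; that is, for every x with F (x,s) = c one has fderiv ℝ (fun x => F (x,s)) x ≠ 0. -/
open MeasureTheory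
open Set Filter Topology Module

/-- Local parametrization of the zero set of `w` near a regular point by the kernel of the
derivative of `w`. -/
theorem exists_contDiffAt_parametrization_zeroSet {E : Type*} [NormedAddCommGroup E]
    [NormedSpace ℝ E] [FiniteDimensional ℝ E] {N : ℕ} (hN : N ≠ 0) {w : E → ℝ} {a : E}
    (hw : ContDiffAt ℝ N w a) (hwa : w a = 0) (hw' : fderiv ℝ w a ≠ 0) :
    ∃ (φ : (fderiv ℝ w a).ker → E) (p : E → (fderiv ℝ w a).ker),
      ContDiffAt ℝ N φ 0 ∧ φ 0 = a ∧ Tendsto p (𝓝 a) (𝓝 0) ∧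
      (∀ᶠ u in 𝓝 0, w (φ u) = 0) ∧ ∀ᶠ y in 𝓝 a, w y = 0 → φ (p y) = y := by
  have : CompleteSpace E := FiniteDimensional.complete ℝ E
  have hN' : (N : WithTop ℕ∞) ≠ 0 := by exact_mod_cast hN
  set L := fderiv ℝ w a
  obtain ⟨P, hP⟩ : ∃ P : E →L[ℝ] L.ker, ∀ u : L.ker, P u = u :=
    Submodule.ClosedComplemented.of_finiteDimensional L.ker
  have hLsurj : L.range = ⊤ := by
    refine LinearMap.range_eq_top.2 (LinearMap.surjective ?_)
    intro h
    exact hw' (by ext v; exact congrArg (fun l : E →ₗ[ℝ] ℝ => l v) h)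
  have hPsurj : P.range = ⊤ := LinearMap.range_eq_top.2 fun u => ⟨u, hP u⟩
  let D : ImplicitFunctionData ℝ E ℝ L.ker :=
    { leftFun := w
      leftDeriv := L
      rightFun := fun y => P (y - a)
      rightDeriv := P
      pt := a
      hasStrictFDerivAt_leftFun := hw.hasStrictFDerivAt hN'
      hasStrictFDerivAt_rightFun :=
        P.hasStrictFDerivAt.comp a ((hasStrictFDerivAt_id a).sub_const a)
      range_leftDeriv := hLsurj
      range_rightDeriv := hPsurj
      isCompl_ker := LinearMap.isCompl_of_proj hP }
  have hsmooth : ContDiffAt ℝ N D.implicitFunction.uncurry (D.prodFun D.pt) :=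
    D.contDiffAt_implicitFunction hw (by
      change ContDiffAt ℝ N (fun y => P (y - a)) a
      fun_prop) hN'
  have hpt : D.prodFun D.pt = ((0 : ℝ), (0 : L.ker)) := by
    simp [D, ImplicitFunctionData.prodFun, hwa]
  rw [hpt] at hsmooth
  have hmk : Tendsto (fun u : L.ker => ((0 : ℝ), u)) (𝓝 0) (𝓝 (0, 0)) := by
    rw [nhds_prod_eq]
    exact tendsto_const_nhds.prodMk tendsto_id
  have himg := D.implicitFunction_apply_image
  refine ⟨D.implicitFunction 0, fun y => P (y - a), ?_, ?_, ?_, ?_, ?_⟩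
  · exact ContDiffAt.comp (0 : L.ker) (f := fun u : L.ker => ((0 : ℝ), u)) hsmooth
      (contDiffAt_const.prodMk contDiffAt_id)
  · have := himg.self_of_nhds
    simpa [D, hwa] using this
  · have : Continuous fun y => P (y - a) := by fun_prop
    simpa using this.tendsto a
  · have := D.leftFun_implicitFunction
    rw [hpt] at this
    exact hmk.eventually this
  · filter_upwards [himg] with y hy hwy
    simpa [D, hwy] using hy

/-- If a Sard-type theorem holds on the kernel of the derivative of `w`, then near a regular point
of `w` the critical values of the restriction of `f` to the zero set of `w` have measure zero. -/
theorem exists_nhds_volume_image_constrained_critical_eq_zero {E : Type*} [NormedAddCommGroup E]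
    [NormedSpace ℝ E] [FiniteDimensional ℝ E] {N : ℕ} (hN : N ≠ 0) {f w : E → ℝ} {a : E}
    (hf : ContDiffAt ℝ N f a)
    (hw : ContDiffAt ℝ N w a) (hwa : w a = 0) (hw' : fderiv ℝ w a ≠ 0)
    (sard : ∀ (g : (fderiv ℝ w a).ker → ℝ) (u : (fderiv ℝ w a).ker), ContDiffAt ℝ N g u →
      ∃ V ∈ 𝓝 u, volume (g '' (V ∩ {x | fderiv ℝ g x = 0})) = 0) :
    ∃ V ∈ 𝓝 a,
      volume (f '' (V ∩ {y | w y = 0 ∧ ∃ r : ℝ, fderiv ℝ f y = r • fderiv ℝ w y})) = 0 := by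
  obtain ⟨φ, p, hφ, hφ0, hp, hwφ, hφp⟩ :=
    exists_contDiffAt_parametrization_zeroSet hN hw hwa hw'
  have hN' : (N : WithTop ℕ∞) ≠ 0 := by exact_mod_cast hN
  have hφd : ∀ᶠ u in 𝓝 0, DifferentiableAt ℝ φ u :=
    (hφ.eventually (by simp)).mono fun _ h => h.differentiableAt hN'
  have hfd : ∀ᶠ y in 𝓝 a, DifferentiableAt ℝ f y :=
    (hf.eventually (by simp)).mono fun _ h => h.differentiableAt hN'
  have hwd : ∀ᶠ y in 𝓝 a, DifferentiableAt ℝ w y :=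
    (hw.eventually (by simp)).mono fun _ h => h.differentiableAt hN'
  obtain ⟨W, hW, hW0⟩ := sard (f ∘ φ) 0 (ContDiffAt.comp 0 (by rwa [hφ0]) hφ)
  refine ⟨{y | (w y = 0 → φ (p y) = y) ∧ p y ∈ W ∧ DifferentiableAt ℝ φ (p y) ∧
    DifferentiableAt ℝ f y ∧ DifferentiableAt ℝ w y ∧ ∀ᶠ u in 𝓝 (p y), w (φ u) = 0}, ?_, ?_⟩
  · exact hφp.and ((hp.eventually hW).and ((hp.eventually hφd).and
      (hfd.and (hwd.and (hp.eventually hwφ.eventually_nhds)))))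
  · refine measure_mono_null ?_ hW0
    rintro _ ⟨y, ⟨⟨hy, hyW, hφy, hfy, hwy, hev⟩, hwy0, r, hr⟩, rfl⟩
    have hy := hy hwy0
    refine ⟨p y, ⟨hyW, ?_⟩, congrArg f hy⟩
    have h1 : fderiv ℝ (w ∘ φ) (p y) = 0 := by
      have : w ∘ φ =ᶠ[𝓝 (p y)] fun _ => 0 := hev
      rw [this.fderiv_eq]
      simp
    rw [fderiv_comp _ (by rwa [hy]) hφy, hy] at h1
    change fderiv ℝ (f ∘ φ) (p y) = 0
    rw [fderiv_comp _ (by rwa [hy]) hφy, hy, hr, ContinuousLinearMap.smul_comp, h1, smul_zero]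

/-- Taylor estimate, locally uniform in the base point: if the derivatives of `f` of orders
`1, …, n` vanish at `x`, then `f y - f x` is `O(‖y - x‖ ^ (n + 1))`. -/
theorem exists_nhds_norm_sub_le_of_iteratedFDeriv_eq_zero {E F : Type*} [NormedAddCommGroup E]
    [NormedSpace ℝ E] [NormedAddCommGroup F] [NormedSpace ℝ F] {n : ℕ} {f : E → F} {a : E}
    (hf : ContDiffAt ℝ (n + 1 : ℕ) f a) :
    ∃ C : NNReal, ∃ V ∈ 𝓝 a, ∀ x ∈ V, (∀ i, 1 ≤ i → i ≤ n → iteratedFDeriv ℝ i f x = 0) →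
      ∀ y ∈ V, ‖f y - f x‖ ≤ C * ‖y - x‖ ^ (n + 1) := by
  have hev := hf.eventually (by simp)
  have hcont : ContinuousAt (fun y => ‖iteratedFDeriv ℝ (n + 1) f y‖) a :=
    (hf.iteratedFDeriv_right (m := 0) (i := n + 1) (by simp)).continuousAt.norm
  have hbd : ∀ᶠ y in 𝓝 a,
      ‖iteratedFDeriv ℝ (n + 1) f y‖ < ‖iteratedFDeriv ℝ (n + 1) f a‖ + 1 :=
    hcont.eventually (gt_mem_nhds (by simp))
  obtain ⟨ε, hε, hball⟩ := Metric.eventually_nhds_iff_ball.1 (hev.and hbd)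
  refine ⟨⟨‖iteratedFDeriv ℝ (n + 1) f a‖ + 1, by positivity⟩, Metric.ball a ε,
    Metric.ball_mem_nhds a hε, fun x hx hflat => ?_⟩
  set C : ℝ := ‖iteratedFDeriv ℝ (n + 1) f a‖ + 1
  have hC0 : 0 ≤ C := by positivity
  have key : ∀ j ≤ n, ∀ y ∈ Metric.ball a ε,
      ‖iteratedFDeriv ℝ (n - j) f y - iteratedFDeriv ℝ (n - j) f x‖ ≤ C * ‖y - x‖ ^ (j + 1) := by
    intro j hj
    have hstep : ∀ i ≤ n, ∀ k : ℕ,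
        (∀ z ∈ Metric.ball a ε, ‖iteratedFDeriv ℝ (i + 1) f z‖ ≤ C * ‖z - x‖ ^ k) →
        ∀ y ∈ Metric.ball a ε,
          ‖iteratedFDeriv ℝ i f y - iteratedFDeriv ℝ i f x‖ ≤ C * ‖y - x‖ ^ (k + 1) := by
      intro i hi k hk y hy
      have hseg : segment ℝ x y ⊆ Metric.ball a ε := (convex_ball a ε).segment_subset hx hy
      have := (convex_segment x y).norm_image_sub_le_of_norm_fderiv_le (𝕜 := ℝ)
        (f := iteratedFDeriv ℝ i f) (C := C * ‖y - x‖ ^ k) (x := x) (y := y)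
        (fun z hz => ((hball z (hseg hz)).1.iteratedFDeriv_right (m := 1) (i := i) (by
          norm_cast; omega)).differentiableAt (by simp))
        (fun z hz => by
          rw [norm_fderiv_iteratedFDeriv]
          refine (hk z (hseg hz)).trans ?_
          gcongr
          exact norm_sub_le_of_mem_segment hz)
        (left_mem_segment ℝ x y) (right_mem_segment ℝ x y)
      rwa [pow_succ, ← mul_assoc]
    induction j with
    | zero =>
      refine hstep n le_rfl 0 fun z hz => ?_
      simpa using (hball z hz).2.le
    | succ j ih =>
      refine hstep (n - (j + 1)) (by omega) (j + 1) fun z hz => ?_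
      have h := ih (by omega) z hz
      rw [hflat (n - j) (by omega) (by omega), sub_zero] at h
      rwa [show n - (j + 1) + 1 = n - j by omega]
  intro y hy
  have h := key n le_rfl y hy
  rw [Nat.sub_self] at h
  refine le_trans ?_ h
  simpa using (iteratedFDeriv ℝ 0 f y - iteratedFDeriv ℝ 0 f x).le_opNorm 0

/-- The image of the set of points where all derivatives of order `1, …, dim E` vanish
is locally of measure zero. -/
theorem exists_nhds_volume_image_flat_eq_zero {E : Type*} [NormedAddCommGroup E]
    [NormedSpace ℝ E] [FiniteDimensional ℝ E] {n : ℕ} (hn : finrank ℝ E = n) {f : E → ℝ} {a : E}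
    (hf : ContDiffAt ℝ (n + 1 : ℕ) f a) :
    ∃ V ∈ 𝓝 a,
      volume (f '' (V ∩ {x | ∀ i, 1 ≤ i → i ≤ n → iteratedFDeriv ℝ i f x = 0})) = 0 := by
  obtain ⟨C, V, hV, h⟩ := exists_nhds_norm_sub_le_of_iteratedFDeriv_eq_zero hf
  refine ⟨V, hV, ?_⟩
  set A := V ∩ {x | ∀ i, 1 ≤ i → i ≤ n → iteratedFDeriv ℝ i f x = 0}
  have hold : HolderOnWith C (n + 1 : ℕ) f A := by
    intro x hx y hy
    have := h x hx.1 hx.2 y hy.1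
    rw [edist_comm (f x), edist_comm x, edist_nndist, edist_nndist, NNReal.coe_natCast,
      ENNReal.rpow_natCast]
    norm_cast
    rw [← NNReal.coe_le_coe]
    simpa [dist_eq_norm] using this
  have hdim : dimH (f '' A) < (1 : NNReal) := by
    refine (hold.dimH_image_le (by positivity)).trans_lt ?_
    have hA : dimH A ≤ n := by
      rw [← hn, ← Real.dimH_univ_eq_finrank E]
      exact dimH_mono (subset_univ _)
    refine ENNReal.div_lt_of_lt_mul ?_
    refine hA.trans_lt ?_
    norm_num
    exact_mod_cast Nat.lt_succ_self n
  have := hausdorffMeasure_of_dimH_lt hdim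
  rwa [NNReal.coe_one, hausdorffMeasure_real] at this

/-- A set is mapped to a null set if this holds locally near each of its points. -/
theorem measure_image_eq_zero_of_locally {X Y : Type*} [TopologicalSpace X]
    [SecondCountableTopology X] [MeasurableSpace Y] (μ : Measure Y) (f : X → Y) (s : Set X)
    (h : ∀ x ∈ s, ∃ V ∈ 𝓝 x, μ (f '' (V ∩ s)) = 0) : μ (f '' s) = 0 := by
  have := measure_null_of_locally_null (μ := OuterMeasure.comap f μ.toOuterMeasure) s
    fun x hx => by
      obtain ⟨V, hV, h0⟩ := h x hx
      exact ⟨V ∩ s, inter_mem (mem_nhdsWithin_of_mem_nhds hV) self_mem_nhdsWithin, by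
        simpa using h0⟩
  simpa using this

/-- The **Morse–Sard theorem** for real-valued functions, in local form. -/
theorem exists_forall_exists_nhds_volume_image_critical_eq_zero.{u} (n : ℕ) :
    ∃ N : ℕ, ∀ (E : Type u) [NormedAddCommGroup E] [NormedSpace ℝ E] [FiniteDimensional ℝ E],
      finrank ℝ E = n → ∀ (f : E → ℝ) (a : E), ContDiffAt ℝ N f a →
        ∃ V ∈ 𝓝 a, volume (f '' (V ∩ {x | fderiv ℝ f x = 0})) = 0 := by
  induction n with
  | zero =>
    refine ⟨0, fun E _ _ _ hE f a _ => ⟨univ, univ_mem, ?_⟩⟩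
    have := finrank_zero_iff.1 hE
    exact (subsingleton_of_subsingleton.image f).measure_zero _
  | succ n ih =>
    obtain ⟨N, hN⟩ := ih
    refine ⟨N + n + 3, fun E _ _ _ hE f a hf => ?_⟩
    obtain ⟨V, hV, hflat⟩ := exists_nhds_volume_image_flat_eq_zero hE
      (hf.of_le (by norm_cast; omega))
    let S : ℕ → Set E := fun k => {x | ContDiffAt ℝ (N + n + 3 : ℕ) f x ∧ fderiv ℝ f x = 0 ∧
      iteratedFDeriv ℝ k f x = 0 ∧ iteratedFDeriv ℝ (k + 1) f x ≠ 0}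
    have hS : ∀ k ≤ n, volume (f '' S k) = 0 := by
      refine fun k hk => measure_image_eq_zero_of_locally _ _ _ fun x ⟨hx, hx1, hx2, hx3⟩ => ?_
      have hD : ContDiffAt ℝ (N + 1 : ℕ) (iteratedFDeriv ℝ k f) x :=
        hx.iteratedFDeriv_right (by norm_cast; omega)
      have hD1 : DifferentiableAt ℝ (iteratedFDeriv ℝ k f) x := hD.differentiableAt (by simp)
      have hne : fderiv ℝ (iteratedFDeriv ℝ k f) x ≠ 0 := by
        intro h0
        refine hx3 (ContinuousMultilinearMap.ext fun v => ?_)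
        rw [iteratedFDeriv_succ_apply_left, h0]
        rfl
      obtain ⟨v, hv⟩ : ∃ v, fderiv ℝ (fun y => iteratedFDeriv ℝ k f y v) x ≠ 0 := by
        by_contra! hcon
        refine hne ?_
        ext u v
        have hval : HasFDerivAt (fun y => iteratedFDeriv ℝ k f y v)
            ((ContinuousMultilinearMap.apply ℝ (fun _ : Fin k => E) ℝ v).comp
              (fderiv ℝ (iteratedFDeriv ℝ k f) x)) x :=
          (ContinuousMultilinearMap.apply ℝ (fun _ : Fin k => E) ℝ v).hasFDerivAt.comp x
            hD1.hasFDerivAt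
        have := congrArg (fun l : E →L[ℝ] ℝ => l u) (hval.fderiv.symm.trans (hcon v))
        simpa using this
      obtain ⟨W, hW, hW0⟩ := exists_nhds_volume_image_constrained_critical_eq_zero
        (N := N + 1) (by omega) (f := f) (w := fun y => iteratedFDeriv ℝ k f y v) (a := x)
        (hx.of_le (by norm_cast; omega))
        ((ContinuousMultilinearMap.apply ℝ (fun _ : Fin k => E) ℝ v).contDiff.contDiffAt.comp x hD)
        (by simp [hx2]) hv
        (fun g u hg => hN _ (by
          have := Module.Dual.finrank_ker_add_one_of_ne_zero
            (f := (fderiv ℝ (fun y => iteratedFDeriv ℝ k f y v) x).toLinearMap)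
            (fun h0 => hv (ContinuousLinearMap.coe_injective h0))
          omega) g u (hg.of_le (by norm_cast; omega)))
      refine ⟨W, hW, measure_mono_null (image_mono ?_) hW0⟩
      rintro y ⟨hyW, -, hy1, hy2, -⟩
      exact ⟨hyW, by simp [hy2], 0, by simp [hy1]⟩
    refine ⟨V ∩ {x | ContDiffAt ℝ (N + n + 3 : ℕ) f x},
      inter_mem hV (hf.eventually (WithTop.coe_injective.ne (ENat.natCast_ne_top _))), ?_⟩
    have hU : volume (f '' (⋃ k ∈ Finset.range (n + 1), S k)) = 0 := by
      simp only [image_iUnion]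
      exact (measure_biUnion_null_iff (Finset.countable_toSet _)).2 fun k hk =>
        hS k (by simpa [Nat.lt_succ_iff] using hk)
    refine measure_mono_null ?_ (measure_union_null hflat hU)
    rw [← image_union]
    refine image_mono ?_
    rintro x ⟨⟨hxV, hx⟩, hx1⟩
    by_cases hxf : ∀ i, 1 ≤ i → i ≤ n + 1 → iteratedFDeriv ℝ i f x = 0
    · exact Or.inl ⟨hxV, hxf⟩
    · right
      classical
      push Not at hxf
      obtain ⟨hi1, hi2, hi3⟩ := Nat.find_spec hxf
      have hmin := fun j => Nat.find_min hxf (m := j)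
      set i := Nat.find hxf
      have hone : iteratedFDeriv ℝ 1 f x = 0 := by
        rw [← norm_eq_zero, norm_iteratedFDeriv_one, norm_eq_zero]
        exact hx1
      have hi : i ≠ 1 := fun h => hi3 (h ▸ hone)
      simp only [mem_iUnion]
      refine ⟨i - 1, by simp; omega, hx, hx1, ?_, ?_⟩
      · by_contra hcon
        exact hmin (i - 1) (by omega) ⟨by omega, by omega, hcon⟩
      · rwa [Nat.sub_add_cancel hi1]

/-- Parametric transversality with a one-dimensional parameter: the parameters `t` for which the
slice of `G` at `t` has a critical zero that is regular for `G` form a null set. -/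
theorem volume_image_snd_critical_zeros_eq_zero {X : Type*} [NormedAddCommGroup X]
    [NormedSpace ℝ X] [FiniteDimensional ℝ X] {G : X × ℝ → ℝ} (hG : ContDiff ℝ (⊤ : ℕ∞) G) :
    volume (Prod.snd '' {z : X × ℝ | G z = 0 ∧ (∀ v : X, fderiv ℝ G z (v, 0) = 0) ∧
      fderiv ℝ G z (0, 1) ≠ 0}) = 0 := by
  obtain ⟨N, hN⟩ := exists_forall_exists_nhds_volume_image_critical_eq_zero (finrank ℝ X)
  refine measure_image_eq_zero_of_locally _ _ _ fun z ⟨hz, _, hz'⟩ => ?_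
  have hne : fderiv ℝ G z ≠ 0 := fun h => hz' (by simp [h])
  obtain ⟨V, hV, hV0⟩ := exists_nhds_volume_image_constrained_critical_eq_zero
    (N := N + 1) (by omega) (f := (Prod.snd : X × ℝ → ℝ)) (w := G) (a := z)
    contDiffAt_snd (hG.contDiffAt.of_le (by exact_mod_cast le_top)) hz hne
    (fun g u hg => hN _ (by
      have := Module.Dual.finrank_ker_add_one_of_ne_zero (f := (fderiv ℝ G z).toLinearMap)
        (fun h0 => hne (ContinuousLinearMap.coe_injective h0))
      rw [finrank_prod, finrank_self] at this
      omega) g u (hg.of_le (by norm_cast; omega)))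
  refine ⟨V, hV, measure_mono_null (image_mono ?_) hV0⟩
  rintro y ⟨hyV, hy, hyX, hyt⟩
  refine ⟨hyV, hy, (fderiv ℝ G y (0, 1))⁻¹, ?_⟩
  rw [fderiv_snd]
  ext v
  · simp [hyX]
  · simp [inv_mul_cancel₀ hyt]

/-- Parametric transversality theorem, hypersurface (codimension-one) form:
if the smooth family `F(x, s)` is transverse to the level set at value `c`
(jointly in controls `x` and parameters `s`), then for almost every fixed
parameter `s` the slice landscape `x ↦ F (x, s)` has no critical point on
its level set at value `c`. -/
theorem parametric_transversality_hypersurface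
    (m d : ℕ) (hm : 1 ≤ m) (hd : 1 ≤ d)
    (F : (Fin m → ℝ) × (Fin d → ℝ) → ℝ) (hF : ContDiff ℝ (⊤ : ℕ∞) F) (c : ℝ)
    (htrans : ∀ z : (Fin m → ℝ) × (Fin d → ℝ), F z = c → fderiv ℝ F z ≠ 0) :
    ∀ᵐ s ∂(volume : Measure (Fin d → ℝ)),
      ∀ x : Fin m → ℝ, F (x, s) = c → fderiv ℝ (fun x => F (x, s)) x ≠ 0 := by
  have hF1 : Differentiable ℝ F := hF.differentiable (by simp)
  have hslice : ∀ z : (Fin m → ℝ) × (Fin d → ℝ), fderiv ℝ (fun x => F (x, z.2)) z.1 =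
      (fderiv ℝ F z).comp (ContinuousLinearMap.inl ℝ (Fin m → ℝ) (Fin d → ℝ)) := fun z =>
    ((hF1 z).hasFDerivAt.comp z.1 (hasFDerivAt_prodMk_left z.1 z.2)).fderiv
  have hcont : Continuous (fderiv ℝ F) := hF.continuous_fderiv (by simp)
  set B : Set ((Fin m → ℝ) × (Fin d → ℝ)) := {z | F z = c ∧
    (fderiv ℝ F z).comp (ContinuousLinearMap.inl ℝ (Fin m → ℝ) (Fin d → ℝ)) = 0}
  have hBclosed : IsClosed B :=
    (isClosed_eq hF.continuous continuous_const).inter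
      (isClosed_eq (hcont.clm_comp continuous_const) continuous_const)
  have hnull : volume (Prod.snd '' B) = 0 := by
    refine measure_image_eq_zero_of_locally _ _ _ fun z₀ ⟨hz₀, hz₀'⟩ => ?_
    obtain ⟨v, hv⟩ : ∃ v : Fin d → ℝ, fderiv ℝ F z₀ (0, v) ≠ 0 := by
      by_contra! hcon
      refine htrans z₀ hz₀ ?_
      ext i
      · exact congrArg (fun l : (Fin m → ℝ) →L[ℝ] ℝ => l _) hz₀'
      · exact hcon _
    have hev : ∀ᶠ z in 𝓝 z₀, fderiv ℝ F z (0, v) ≠ 0 :=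
      (hcont.clm_apply continuous_const).continuousAt.eventually_ne hv
    obtain ⟨r, hr, hball⟩ := Metric.nhds_basis_closedBall.eventually_iff.1 hev
    refine ⟨Metric.closedBall z₀ r, Metric.closedBall_mem_nhds z₀ hr, ?_⟩
    have hcpt : IsCompact (Prod.snd '' (Metric.closedBall z₀ r ∩ B)) :=
      ((isCompact_closedBall z₀ r).inter_right hBclosed).image continuous_snd
    refine measure_eq_zero_iff_ae_notMem.2 <|
      ae_mem_of_ae_add_linearMap_mem (LinearMap.toSpanSingleton ℝ (Fin d → ℝ) v)
        (volume : Measure ℝ) volume hcpt.measurableSet.compl fun y => ?_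
    let A : (Fin m → ℝ) × ℝ → (Fin m → ℝ) × (Fin d → ℝ) := fun q => (q.1, y + q.2 • v)
    let A' : (Fin m → ℝ) × ℝ →L[ℝ] (Fin m → ℝ) × (Fin d → ℝ) :=
      (ContinuousLinearMap.fst ℝ _ _).prod ((ContinuousLinearMap.snd ℝ _ _).smulRight v)
    have hA : ContDiff ℝ (⊤ : ℕ∞) A := by fun_prop
    have hA' : ∀ q, HasFDerivAt A A' q := fun q =>
      hasFDerivAt_fst.prodMk ((hasFDerivAt_snd.smul_const v).const_add y)
    have hG' : ∀ q, fderiv ℝ (fun q => F (A q) - c) q = (fderiv ℝ F (A q)).comp A' := fun q =>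
      (((hF1 (A q)).hasFDerivAt.comp q (hA' q)).sub_const c).fderiv
    have hG := volume_image_snd_critical_zeros_eq_zero (G := fun q => F (A q) - c)
      ((hF.comp hA).sub contDiff_const)
    filter_upwards [measure_eq_zero_iff_ae_notMem.1 hG] with t ht
    rintro ⟨z, ⟨hzr, hzc, hz'⟩, hzt⟩
    have hAz : A (z.1, t) = z := by
      ext1
      · rfl
      · simpa [A] using hzt.symm
    refine ht ⟨(z.1, t), ⟨?_, fun u => ?_, ?_⟩, rfl⟩
    · simp [hAz, hzc]
    · rw [hG', hAz]
      simpa [A'] using congrArg (fun l : (Fin m → ℝ) →L[ℝ] ℝ => l u) hz'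
    · rw [hG', hAz]
      simpa [A'] using hball hzr
  filter_upwards [measure_eq_zero_iff_ae_notMem.1 hnull] with s hs x hx hx'
  exact hs ⟨(x, s), ⟨hx, (hslice (x, s)).symm.trans hx'⟩, rfl⟩
end

section
/- Let m, d, c ≥ 1 and let Φ : (Fin m → ℝ) × (Fin d → ℝ) → (Fin c → ℝ) be a C^∞ map. Assume 0 is a regular value of Φ, i.e. for every z = (x,s) with Φ z = 0 the Fréchet derivative fderiv ℝ Φ z is surjective. Then for Lebesgue-almost every s ∈ (Fin d → ℝ), 0 is a regular value of the slice map x ↦ Φ (x,s); that is, for every x with Φ (x,s) = 0 the derivative fderiv ℝ (fun x => Φ (x,s)) x is surjective. -/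
open MeasureTheory

open Set Topology Module
open scoped ContDiff NNReal

theorem isOpen_setOf_surjective_continuousLinearMap {E F : Type*} [NormedAddCommGroup E]
    [NormedSpace ℝ E] [FiniteDimensional ℝ E] [NormedAddCommGroup F] [NormedSpace ℝ F]
    [FiniteDimensional ℝ F] : IsOpen {A : E →L[ℝ] F | Function.Surjective A} := by
  have : CompleteSpace F := FiniteDimensional.complete ℝ F
  rw [isOpen_iff_mem_nhds]
  intro A hA
  obtain ⟨R, hR⟩ := A.exists_rightInverse_of_surjective (LinearMap.range_eq_top.2 hA)
  have hc : Filter.Tendsto (fun B : E →L[ℝ] F => B.comp R) (𝓝 A)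
      (𝓝 ((ContinuousLinearEquiv.refl ℝ F : F ≃L[ℝ] F) : F →L[ℝ] F)) := by
    have : Continuous fun B : E →L[ℝ] F => B.comp R := by fun_prop
    simpa [hR] using this.tendsto A
  filter_upwards [hc (ContinuousLinearEquiv.nhds (ContinuousLinearEquiv.refl ℝ F))]
  rintro B ⟨e, he⟩ v
  exact ⟨R (e.symm v), by simpa using (DFunLike.congr_fun he (e.symm v)).symm⟩

/-- A submersion can locally be completed to a chart whose first component it is. -/
theorem exists_chart_of_surjective_fderiv {E G : Type*} [NormedAddCommGroup E] [NormedSpace ℝ E]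
    [FiniteDimensional ℝ E] [NormedAddCommGroup G] [NormedSpace ℝ G] [FiniteDimensional ℝ G]
    {n : ℕ} (hn : finrank ℝ E = finrank ℝ G + n) {w : E → G} {U : Set E} (hU : IsOpen U)
    (hw : ∀ x ∈ U, ContDiffAt ℝ ∞ w x) {x₀ : E} (hx₀ : x₀ ∈ U)
    (hs : Function.Surjective (fderiv ℝ w x₀)) :
    ∃ e : OpenPartialHomeomorph E (G × (Fin n → ℝ)), x₀ ∈ e.source ∧ e.source ⊆ U ∧
      (∀ x ∈ e.source, (e x).1 = w x) ∧ ∀ y ∈ e.target, ContDiffAt ℝ ∞ e.symm y := by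
  have : CompleteSpace E := FiniteDimensional.complete ℝ E
  set A := fderiv ℝ w x₀
  obtain ⟨p, hp⟩ := A.ker_closedComplemented_of_finiteDimensional_range
  have hrank : finrank ℝ A.ker = finrank ℝ (Fin n → ℝ) := by
    have h := LinearMap.finrank_range_add_finrank_ker (A : E →ₗ[ℝ] G)
    rw [LinearMap.range_eq_top.2 hs, finrank_top] at h
    simp only [finrank_fin_fun]
    omega
  let q : A.ker ≃L[ℝ] (Fin n → ℝ) := ContinuousLinearEquiv.ofFinrankEq hrank
  let π : E →L[ℝ] (Fin n → ℝ) := (q : A.ker →L[ℝ] (Fin n → ℝ)).comp p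
  have hinj : Function.Injective (A.prod π) := by
    rw [injective_iff_map_eq_zero]
    intro v hv
    have h1 : A v = 0 := congrArg Prod.fst hv
    have h2 : q (p v) = 0 := congrArg Prod.snd hv
    have h3 := hp ⟨v, h1⟩
    rw [(map_eq_zero_iff q q.injective).1 h2] at h3
    exact (congrArg Subtype.val h3).symm
  let L : E ≃L[ℝ] G × (Fin n → ℝ) := (LinearEquiv.ofInjectiveOfFinrankEq
    (A.prod π : E →ₗ[ℝ] G × (Fin n → ℝ)) hinj (by simp [hn])).toContinuousLinearEquiv
  have hL : (L : E →L[ℝ] G × (Fin n → ℝ)) = A.prod π := by ext <;> rfl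
  let θ : E → G × (Fin n → ℝ) := fun x => (w x, π x)
  have hθ : ∀ x ∈ U, ContDiffAt ℝ ∞ θ x := fun x hx =>
    (hw x hx).prodMk π.contDiff.contDiffAt
  have hθ₀ : HasFDerivAt θ (L : E →L[ℝ] G × (Fin n → ℝ)) x₀ := 
    hL ▸ ((hw x₀ hx₀).differentiableAt (by simp)).hasFDerivAt.prodMk π.hasFDerivAt
  let e₀ := (hθ x₀ hx₀).toOpenPartialHomeomorph θ hθ₀ (by simp)
  have hmem : {x | x ∈ U ∧ fderiv ℝ θ x ∈
      range ContinuousLinearEquiv.toContinuousLinearMap} ∈ 𝓝 x₀ := by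
    have hc : ContinuousAt (fderiv ℝ θ) x₀ :=
      ((hθ x₀ hx₀).fderiv_right (m := 0) (by simp)).continuousAt
    exact Filter.inter_mem (hU.mem_nhds hx₀) (hc (hθ₀.fderiv ▸ L.nhds))
  obtain ⟨V, hV, hVo, hxV⟩ := mem_nhds_iff.1 hmem
  refine ⟨e₀.restrOpen V hVo, ⟨(hθ x₀ hx₀).mem_toOpenPartialHomeomorph_source hθ₀ (by simp), hxV⟩,
    fun x hx => (hV hx.2).1, fun x _ => rfl, fun y hy => ?_⟩
  have hx := (e₀.restrOpen V hVo).map_target hy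
  obtain ⟨hxU, T, hT⟩ := hV hx.2
  exact (e₀.restrOpen V hVo).contDiffAt_symm (f₀' := T) hy 
    (hT ▸ ((hθ _ hxU).differentiableAt (by simp)).hasFDerivAt) (hθ _ hxU)

theorem measure_image_null_of_locally_null {X Y : Type*} [TopologicalSpace X]
    [SecondCountableTopology X] [MeasurableSpace Y] {μ : Measure Y} {f : X → Y} {s : Set X}
    (h : ∀ x ∈ s, ∃ u ∈ 𝓝 x, μ (f '' (s ∩ u)) = 0) : μ (f '' s) = 0 := by
  have := measure_null_of_locally_null (μ := OuterMeasure.comap f μ.toOuterMeasure) s ?_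
  · rwa [OuterMeasure.comap_apply] at this
  · intro x hx
    obtain ⟨u, hu, h0⟩ := h x hx
    exact ⟨s ∩ u, Filter.inter_mem self_mem_nhdsWithin (mem_nhdsWithin_of_mem_nhds hu),
      by rwa [OuterMeasure.comap_apply]⟩

/-- Points at which all derivatives vanish: the flat part of Sard's theorem. -/
theorem volume_image_flat_eq_zero {n p : ℕ} (hp : 1 ≤ p) {f : (Fin n → ℝ) → (Fin p → ℝ)}
    {U : Set (Fin n → ℝ)} (hU : IsOpen U) (hf : ∀ x ∈ U, ContDiffAt ℝ ∞ f x) :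
    volume (f '' {x ∈ U | ∀ k, 1 ≤ k → iteratedFDeriv ℝ k f x = 0}) = 0 := by
  have hcd : ∀ k : ℕ, ∀ x ∈ U, ContDiffAt ℝ ∞ (iteratedFDeriv ℝ k f) x := fun k x hx =>
    (hf x hx).iteratedFDeriv_right (by exact_mod_cast le_top)
  refine measure_image_null_of_locally_null fun x₀ hx₀ => ?_
  obtain ⟨M, hM⟩ : ∃ M : ℝ, ∀ᶠ x in 𝓝 x₀, ‖iteratedFDeriv ℝ (n + 1) f x‖ < M := by
    refine ⟨_, (hcd (n + 1) x₀ hx₀.1).continuousAt.norm.eventually_lt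
      continuousAt_const (lt_add_one _)⟩
  obtain ⟨r, hr, hball⟩ := Metric.mem_nhds_iff.1 (Filter.inter_mem (hU.mem_nhds hx₀.1) hM)
  refine ⟨Metric.ball x₀ r, Metric.ball_mem_nhds _ hr, ?_⟩
  set S := {x ∈ U | ∀ k, 1 ≤ k → iteratedFDeriv ℝ k f x = 0} ∩ Metric.ball x₀ r
  have hM0 : 0 ≤ M := (norm_nonneg _).trans (hball (Metric.mem_ball_self hr)).2.le
  have hbound : ∀ x ∈ S, ∀ j ≤ n, ∀ y ∈ Metric.ball x₀ r,
      ‖iteratedFDeriv ℝ (n + 1 - j) f y‖ ≤ M * ‖y - x‖ ^ j := by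
    intro x hx j
    induction j with
    | zero => intro _ y hy; simpa using (hball hy).2.le
    | succ j ih =>
      intro hj y hy
      have hsub : Metric.ball x₀ r ∩ Metric.closedBall x ‖y - x‖ ⊆ U := fun z hz => (hball hz.1).1
      have := Convex.norm_image_sub_le_of_norm_fderiv_le (𝕜 := ℝ)
        (f := iteratedFDeriv ℝ (n + 1 - (j + 1)) f) (C := M * ‖y - x‖ ^ j)
        (s := Metric.ball x₀ r ∩ Metric.closedBall x ‖y - x‖) (x := x) (y := y)
        (fun z hz => (hcd _ z (hsub hz)).differentiableAt (by simp))
        (fun z hz => by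
          rw [norm_fderiv_iteratedFDeriv, show n + 1 - (j + 1) + 1 = n + 1 - j by omega]
          refine (ih (by omega) z hz.1).trans ?_
          gcongr
          exact mem_closedBall_iff_norm.1 hz.2)
        ((convex_ball _ _).inter (convex_closedBall _ _))
        ⟨hx.2, Metric.mem_closedBall_self (norm_nonneg _)⟩ ⟨hy, by simp [dist_eq_norm]⟩
      rw [hx.1.2 _ (by omega), sub_zero] at this
      rwa [pow_succ, ← mul_assoc]
  have hhol : HolderOnWith M.toNNReal (n + 1 : ℕ) f S := by
    intro x hx y hy
    have key : ‖f y - f x‖ ≤ M * ‖y - x‖ ^ n * ‖y - x‖ := by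
      refine Convex.norm_image_sub_le_of_norm_fderiv_le (𝕜 := ℝ)
        (s := Metric.ball x₀ r ∩ Metric.closedBall x ‖y - x‖)
        (fun z hz => (hf z (hball hz.1).1).differentiableAt (by simp))
        (fun z hz => ?_) ((convex_ball _ _).inter (convex_closedBall _ _))
        ⟨hx.2, Metric.mem_closedBall_self (norm_nonneg _)⟩ ⟨hy.2, by simp [dist_eq_norm]⟩
      rw [← norm_iteratedFDeriv_one]
      have := hbound x hx n le_rfl z hz.1
      rw [show n + 1 - n = 1 by omega] at this
      refine this.trans ?_
      gcongr
      exact mem_closedBall_iff_norm.1 hz.2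
    rw [edist_dist, edist_dist, dist_comm, dist_comm x, dist_eq_norm, dist_eq_norm]
    rw [NNReal.coe_natCast, ENNReal.rpow_natCast, ← ENNReal.ofReal_pow (norm_nonneg _)]
    change _ ≤ ENNReal.ofReal M * _
    rw [← ENNReal.ofReal_mul hM0]
    exact ENNReal.ofReal_le_ofReal (by rwa [pow_succ, ← mul_assoc])
  refine measure_zero_of_dimH_lt (d := (p : ℝ≥0)) ?_ ?_
  · rw [← hausdorffMeasure_pi_real]; simp [Measure.AbsolutelyContinuous.rfl]
  · have h1 := hhol.dimH_image_le (by positivity)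
    have h2 : dimH S ≤ n := by
      simpa using (dimH_mono (subset_univ S)).trans_eq (Real.dimH_univ_eq_finrank (Fin n → ℝ))
    refine (h1.trans (ENNReal.div_le_div_right h2 _)).trans_lt ?_
    refine ENNReal.div_lt_of_lt_mul ?_
    norm_cast
    nlinarith

/-- Sard's theorem for smooth maps from open subsets of `ℝⁿ` into all spaces `ℝᵖ`. -/
def SardInDimension (n : ℕ) : Prop :=
  ∀ (p : ℕ) (f : (Fin n → ℝ) → (Fin p → ℝ)) (U : Set (Fin n → ℝ)), IsOpen U →
    (∀ x ∈ U, ContDiffAt ℝ ∞ f x) →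
      volume (f '' {x ∈ U | ¬ Function.Surjective (fderiv ℝ f x)}) = 0

theorem SardInDimension.volume_image_finite_order_eq_zero {n : ℕ} (ih : SardInDimension n)
    {p : ℕ} (hp : 1 ≤ p) {f : (Fin (n + 1) → ℝ) → (Fin p → ℝ)} {U : Set (Fin (n + 1) → ℝ)}
    (hU : IsOpen U) (hf : ∀ x ∈ U, ContDiffAt ℝ ∞ f x) (k : ℕ) :
    volume (f '' {x ∈ U | fderiv ℝ f x = 0 ∧ iteratedFDeriv ℝ k f x = 0 ∧
      iteratedFDeriv ℝ (k + 1) f x ≠ 0}) = 0 := by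
  refine measure_image_null_of_locally_null fun x₀ ⟨hxU, _, _, hx₀⟩ => ?_
  have hcd : ∀ x ∈ U, ContDiffAt ℝ ∞ (iteratedFDeriv ℝ k f) x := fun x hx =>
    (hf x hx).iteratedFDeriv_right (by exact_mod_cast le_top)
  obtain ⟨v, hv⟩ : ∃ v, fderiv ℝ (iteratedFDeriv ℝ k f) x₀ v ≠ 0 := by
    by_contra! h
    apply hx₀
    rw [← norm_eq_zero, ← norm_fderiv_iteratedFDeriv,
      show fderiv ℝ (iteratedFDeriv ℝ k f) x₀ = 0 from ContinuousLinearMap.ext h]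
    exact ContinuousLinearMap.opNorm_zero
  obtain ⟨l, hl⟩ := SeparatingDual.exists_ne_zero (R := ℝ) hv
  have hsurj : Function.Surjective (fderiv ℝ (fun x => l (iteratedFDeriv ℝ k f x)) x₀) := by
    refine LinearMap.surjective (f := (fderiv ℝ (fun x => l (iteratedFDeriv ℝ k f x)) x₀ :
      (Fin (n + 1) → ℝ) →ₗ[ℝ] ℝ)) fun h => hl ?_
    have h1 := (l.hasFDerivAt.comp x₀
      ((hcd x₀ hxU).differentiableAt (by simp)).hasFDerivAt).fderiv
    have h2 := LinearMap.congr_fun h v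
    change fderiv ℝ (l ∘ iteratedFDeriv ℝ k f) x₀ v = 0 at h2
    rwa [h1] at h2
  obtain ⟨e, hxe, heU, hew, hes⟩ := exists_chart_of_surjective_fderiv (n := n)
    (by simp [add_comm]) hU (fun x hx => l.contDiff.contDiffAt.comp x (hcd x hx)) hxU hsurj
  refine ⟨e.source, e.open_source.mem_nhds hxe, ?_⟩
  have hι : ContDiff ℝ ∞ (fun y : Fin n → ℝ => ((0 : ℝ), y)) := by fun_prop
  have hcomp : ∀ y : Fin n → ℝ, ((0 : ℝ), y) ∈ e.target →
      ContDiffAt ℝ ∞ (fun y : Fin n → ℝ => e.symm (0, y)) y := fun y hy =>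
    (hes _ hy).comp y hι.contDiffAt
  refine measure_mono_null ?_ (ih p (fun y => f (e.symm (0, y)))
    {y | ((0 : ℝ), y) ∈ e.target} (e.open_target.preimage hι.continuous)
    fun y hy => (hf _ (heU (e.map_target hy))).comp y (hcomp y hy))
  rintro _ ⟨x, ⟨⟨hx, hx1, hxk, -⟩, hxs⟩, rfl⟩
  have hex : ((0 : ℝ), (e x).2) = e x := Prod.ext (by simp [hew x hxs, hxk]) rfl
  have hsymm : e.symm (0, (e x).2) = x := by rw [hex, e.left_inv hxs]
  have hmem : ((0 : ℝ), (e x).2) ∈ e.target := hex ▸ e.map_source hxs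
  refine ⟨(e x).2, ⟨hmem, fun hs => ?_⟩, by simp only [hsymm]⟩
  have hd : HasFDerivAt f (0 : (Fin (n + 1) → ℝ) →L[ℝ] (Fin p → ℝ)) (e.symm (0, (e x).2)) := by
    rw [hsymm, ← hx1]
    exact ((hf x hx).differentiableAt (by simp)).hasFDerivAt
  have h0 := (hd.comp (e x).2 ((hcomp _ hmem).differentiableAt (by simp)).hasFDerivAt).fderiv
  obtain ⟨z, hz⟩ := hs 1
  change fderiv ℝ (f ∘ fun y : Fin n → ℝ => e.symm (0, y)) (e x).2 z = 1 at hz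
  rw [h0] at hz
  simpa using congrFun hz ⟨0, hp⟩

theorem SardInDimension.volume_image_fderiv_ne_zero {n : ℕ} (ih : SardInDimension n)
    {q : ℕ} {f : (Fin (n + 1) → ℝ) → (Fin (q + 1) → ℝ)} {U : Set (Fin (n + 1) → ℝ)}
    (hU : IsOpen U) (hf : ∀ x ∈ U, ContDiffAt ℝ ∞ f x) :
    volume (f '' {x ∈ U | fderiv ℝ f x ≠ 0 ∧ ¬ Function.Surjective (fderiv ℝ f x)}) = 0 := by
  refine measure_image_null_of_locally_null fun x₀ ⟨hxU, hx₀, _⟩ => ?_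
  have hfd : ∀ x ∈ U, HasFDerivAt f (fderiv ℝ f x) x := fun x hx =>
    ((hf x hx).differentiableAt (by simp)).hasFDerivAt
  obtain ⟨v, i, hv⟩ : ∃ v i, fderiv ℝ f x₀ v i ≠ 0 := by
    by_contra! h
    exact hx₀ (ContinuousLinearMap.ext fun v => funext (h v))
  have hsurj : Function.Surjective (fderiv ℝ (fun x => f x i) x₀) := by
    refine LinearMap.surjective (f := (fderiv ℝ (fun x => f x i) x₀ :
      (Fin (n + 1) → ℝ) →ₗ[ℝ] ℝ)) fun h => hv ?_
    have h2 := LinearMap.congr_fun h v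
    change fderiv ℝ (fun x => f x i) x₀ v = 0 at h2
    rwa [(hasFDerivAt_pi'.1 (hfd x₀ hxU) i).fderiv] at h2
  obtain ⟨e, hxe, heU, hew, hes⟩ := exists_chart_of_surjective_fderiv (n := n)
    (by simp [add_comm]) hU (fun x hx => contDiffAt_pi.1 (hf x hx) i) hxU hsurj
  obtain ⟨K, hK, hKt, hKc⟩ := local_compact_nhds (e.open_target.mem_nhds (e.map_source hxe))
  refine ⟨e.source ∩ e ⁻¹' K, Filter.inter_mem (e.open_source.mem_nhds hxe)
    ((e.continuousAt hxe).preimage_mem_nhds hK), ?_⟩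
  let T := {x ∈ e.symm '' K | ¬ Function.Surjective (fderiv ℝ f x)}
  have hKs : e.symm '' K ⊆ e.source := by
    rintro _ ⟨y, hy, rfl⟩
    exact e.map_target (hKt hy)
  have hTc : IsCompact T := by
    have hKc' : IsCompact (e.symm '' K) :=
      hKc.image_of_continuousOn (e.continuousOn_symm.mono hKt)
    have hfc : ContinuousOn (fderiv ℝ f) (e.symm '' K) := fun x hx =>
      ((hf x (heU (hKs hx))).fderiv_right (m := 0) (by simp)).continuousAt.continuousWithinAt
    exact hKc'.of_isClosed_subset (hfc.preimage_isClosed_of_isClosed hKc'.isClosed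
      isOpen_setOf_surjective_continuousLinearMap.isClosed_compl) fun x hx => hx.1
  have hfT : IsCompact (f '' T) := hTc.image_of_continuousOn fun x hx =>
    (hf x (heU (hKs hx.1))).continuousAt.continuousWithinAt
  refine measure_mono_null (t := f '' T) ?_ ?_
  · rintro _ ⟨x, ⟨⟨_, _, hx⟩, hxs, hxK⟩, rfl⟩
    exact ⟨x, ⟨⟨e x, hxK, e.left_inv hxs⟩, hx⟩, rfl⟩
  let ρ := MeasurableEquiv.piFinSuccAbove (fun _ : Fin (q + 1) => ℝ) i
  have hρ : MeasurePreserving ρ.symm volume volume :=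
    (volume_preserving_piFinSuccAbove (fun _ : Fin (q + 1) => ℝ) i).symm ρ
  rw [← hρ.measure_preimage_equiv, Measure.volume_eq_prod, Measure.measure_prod_null
    (ρ.symm.measurable hfT.measurableSet)]
  refine Filter.Eventually.of_forall fun t => ?_
  let R : (Fin (q + 1) → ℝ) →L[ℝ] (Fin q → ℝ) :=
    ContinuousLinearMap.pi fun j => ContinuousLinearMap.proj (i.succAbove j)
  have hι : ContDiff ℝ ∞ (fun y : Fin n → ℝ => (t, y)) := by fun_prop
  have hcomp : ∀ y : Fin n → ℝ, (t, y) ∈ e.target →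
      ContDiffAt ℝ ∞ (fun y : Fin n → ℝ => e.symm (t, y)) y := fun y hy =>
    (hes _ hy).comp y hι.contDiffAt
  refine measure_mono_null ?_ (ih q (fun y => R (f (e.symm (t, y))))
    {y | (t, y) ∈ e.target} (e.open_target.preimage hι.continuous)
    fun y hy => R.contDiff.contDiffAt.comp y
      ((hf _ (heU (e.map_target hy))).comp y (hcomp y hy)))
  rintro b ⟨x, ⟨hxK, hx⟩, hxb⟩
  have hxs := hKs hxK
  have hρx : ρ (f x) = (t, b) := by rw [hxb, ρ.apply_symm_apply]
  have hti : f x i = t := congrArg Prod.fst hρx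
  have hex : (t, (e x).2) = e x := Prod.ext (by rw [hew x hxs, hti]) rfl
  have hsymm : e.symm (t, (e x).2) = x := by rw [hex, e.left_inv hxs]
  have hmem : (t, (e x).2) ∈ e.target := hex ▸ e.map_source hxs
  refine ⟨(e x).2, ⟨hmem, fun hs => hx ?_⟩, ?_⟩
  · set D := fderiv ℝ e.symm (e x)
    have hD : HasFDerivAt e.symm D (t, (e x).2) := by
      rw [hex]
      exact ((hes _ (e.map_source hxs)).differentiableAt (by simp)).hasFDerivAt
    have hfx : HasFDerivAt f (fderiv ℝ f x) (e.symm (t, (e x).2)) := by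
      rw [hsymm]
      exact hfd x (heU hxs)
    have hfD := hfx.comp _ hD
    have hfst : ∀ a, fderiv ℝ f x (D a) i = a.1 := by
      intro a
      have h1 := hasFDerivAt_pi'.1 hfD i
      have h2 : HasFDerivAt (fun y => (f ∘ e.symm) y i) (ContinuousLinearMap.fst ℝ ℝ (Fin n → ℝ))
          (t, (e x).2) := by
        refine hasFDerivAt_fst.congr_of_eventuallyEq ?_
        filter_upwards [e.open_target.mem_nhds hmem] with y hy
        simp [← hew _ (e.map_target hy), e.right_inv hy]
      exact DFunLike.congr_fun (h1.unique h2) a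
    have hslice : fderiv ℝ (fun y => R (f (e.symm (t, y)))) (e x).2 =
        R.comp (((fderiv ℝ f x).comp D).comp (ContinuousLinearMap.inr ℝ ℝ (Fin n → ℝ))) :=
      (R.hasFDerivAt.comp (e x).2 (hfD.comp (e x).2 (hasFDerivAt_prodMk_right t _))).fderiv
    intro v
    obtain ⟨y, hy⟩ := hs (R (v - fderiv ℝ f x (D (v i, 0))))
    rw [hslice] at hy
    refine ⟨D (v i, y), funext fun j => ?_⟩
    rcases Fin.eq_self_or_eq_succAbove i j with rfl | ⟨j, rfl⟩
    · exact hfst _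
    · have hj := congrFun hy j
      simp only [ContinuousLinearMap.comp_apply, ContinuousLinearMap.inr_apply, R,
        ContinuousLinearMap.pi_apply, ContinuousLinearMap.proj_apply, Pi.sub_apply] at hj
      rw [show ((v i, y) : ℝ × (Fin n → ℝ)) = (v i, 0) + (0, y) by simp, map_add, map_add,
        Pi.add_apply, hj]
      ring
  · simp only [hsymm]
    exact congrArg Prod.snd hρx

/-- **Sard's theorem**: the critical values of a smooth map on an open subset of `ℝⁿ` form a
null set. -/
theorem sardInDimension (n : ℕ) : SardInDimension n := by
  induction n with
  | zero =>
    intro p f U _ _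
    rcases p with _ | q
    · simp [Function.surjective_to_subsingleton]
    · exact (Set.Subsingleton.image (fun _ _ _ _ => Subsingleton.elim _ _) f).measure_zero volume
  | succ n ih =>
    intro p f U hU hf
    rcases p with _ | q
    · simp [Function.surjective_to_subsingleton]
    refine measure_mono_null ?_ (measure_union_null (ih.volume_image_fderiv_ne_zero hU hf)
      (measure_union_null (measure_iUnion_null
        (ih.volume_image_finite_order_eq_zero q.succ_pos hU hf))
        (volume_image_flat_eq_zero q.succ_pos hU hf)))
    rintro _ ⟨x, ⟨hxU, hx⟩, rfl⟩
    by_cases h0 : fderiv ℝ f x = 0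
    · right
      by_cases hflat : ∀ k, 1 ≤ k → iteratedFDeriv ℝ k f x = 0
      · exact Or.inr ⟨x, ⟨hxU, hflat⟩, rfl⟩
      · left
        by_contra hcon
        refine hflat fun k hk => ?_
        induction k, hk using Nat.le_induction with
        | base => rwa [← norm_eq_zero, norm_iteratedFDeriv_one, norm_eq_zero]
        | succ k _ hk =>
          by_contra hk'
          exact hcon (mem_iUnion.2 ⟨k, x, ⟨hxU, h0, hk, hk'⟩, rfl⟩)
    · exact Or.inl ⟨x, ⟨hxU, h0, hx⟩, rfl⟩

/-- Parametric transversality theorem in Euclidean regular-value form: if `0` is a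
regular value of the joint map `Φ(x, s)`, then for almost every fixed parameter `s`,
`0` is a regular value of the slice map `x ↦ Φ (x, s)`. -/
theorem parametric_transversality_regular_value
    (m d c : ℕ) (hm : 1 ≤ m) (hd : 1 ≤ d) (hc : 1 ≤ c)
    (Φ : (Fin m → ℝ) × (Fin d → ℝ) → (Fin c → ℝ)) (hΦ : ContDiff ℝ (⊤ : ℕ∞) Φ)
    (hreg : ∀ z : (Fin m → ℝ) × (Fin d → ℝ), Φ z = 0 →
      Function.Surjective (fderiv ℝ Φ z)) :
    ∀ᵐ s ∂(volume : Measure (Fin d → ℝ)),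
      ∀ x : Fin m → ℝ, Φ (x, s) = 0 →
        Function.Surjective (fderiv ℝ (fun x => Φ (x, s)) x) := by
  have hΦd : ∀ z, HasFDerivAt Φ (fderiv ℝ Φ z) z := fun z =>
    (hΦ.differentiable (by simp) z).hasFDerivAt
  have hnull : volume (Prod.snd '' {z : (Fin m → ℝ) × (Fin d → ℝ) | Φ z = 0 ∧
      ¬ Function.Surjective (fderiv ℝ (fun x => Φ (x, z.2)) z.1)}) = 0 := by
    refine measure_image_null_of_locally_null fun z₀ ⟨hz₀, _⟩ => ?_
    have hle := LinearMap.finrank_le_finrank_of_surjective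
      (f := (fderiv ℝ Φ z₀).toLinearMap) (hreg z₀ hz₀)
    obtain ⟨n, hn⟩ := Nat.exists_eq_add_of_le hle
    obtain ⟨e, hze, -, hew, hes⟩ := exists_chart_of_surjective_fderiv hn isOpen_univ
      (fun z _ => hΦ.contDiffAt) (mem_univ z₀) (hreg z₀ hz₀)
    refine ⟨e.source, e.open_source.mem_nhds hze, ?_⟩
    let ψ : (Fin n → ℝ) → (Fin m → ℝ) × (Fin d → ℝ) := fun y => e.symm (0, y)
    have hι : ContDiff ℝ ∞ (fun y : Fin n → ℝ => ((0 : Fin c → ℝ), y)) := by fun_prop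
    have hV : IsOpen {y : Fin n → ℝ | ((0 : Fin c → ℝ), y) ∈ e.target} :=
      e.open_target.preimage hι.continuous
    have hψ : ∀ y, ((0 : Fin c → ℝ), y) ∈ e.target → ContDiffAt ℝ ∞ ψ y := fun y hy =>
      (hes _ hy).comp y hι.contDiffAt
    refine measure_mono_null ?_ (sardInDimension n d (fun y => (ψ y).2) _ hV
      fun y hy => contDiff_snd.contDiffAt.comp y (hψ y hy))
    rintro _ ⟨z, ⟨⟨hz, hns⟩, hzs⟩, rfl⟩
    have hez : ((0 : Fin c → ℝ), (e z).2) = e z := Prod.ext (by rw [hew z hzs, hz]) rfl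
    have hψz : ψ (e z).2 = z := by simp only [ψ, hez, e.left_inv hzs]
    have hmem : ((0 : Fin c → ℝ), (e z).2) ∈ e.target := hez ▸ e.map_source hzs
    refine ⟨(e z).2, ⟨hmem, fun hs => hns ?_⟩, by simp only [hψz]⟩
    have hψd := ((hψ _ hmem).differentiableAt (by simp)).hasFDerivAt
    set D := fderiv ℝ ψ (e z).2
    have hzero : ∀ a, fderiv ℝ Φ z (D a) = 0 := by
      have hΦψ : HasFDerivAt Φ (fderiv ℝ Φ z) (ψ (e z).2) := by
        rw [hψz]
        exact hΦd z
      have h1 := hΦψ.comp _ hψd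
      have h2 : HasFDerivAt (Φ ∘ ψ) (0 : (Fin n → ℝ) →L[ℝ] (Fin c → ℝ)) (e z).2 := by
        refine (hasFDerivAt_const (0 : Fin c → ℝ) _).congr_of_eventuallyEq ?_
        filter_upwards [hV.mem_nhds hmem] with y hy
        simp [ψ, ← hew _ (e.map_target hy), e.right_inv hy]
      exact DFunLike.congr_fun (h1.unique h2)
    have hslice : fderiv ℝ (fun x => Φ (x, z.2)) z.1 =
        (fderiv ℝ Φ z).comp (ContinuousLinearMap.inl ℝ (Fin m → ℝ) (Fin d → ℝ)) :=
      ((hΦd z).comp z.1 (hasFDerivAt_prodMk_left z.1 z.2)).fderiv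
    intro v
    obtain ⟨⟨a, b⟩, hab⟩ := hreg z hz v
    obtain ⟨y, hy⟩ := hs b
    rw [hψd.snd.fderiv] at hy
    refine ⟨a - (D y).1, ?_⟩
    rw [hslice]
    have hsplit : ((a - (D y).1, 0) : (Fin m → ℝ) × (Fin d → ℝ)) = (a, b) - D y :=
      Prod.ext rfl (by simp [← hy])
    simp [hsplit, hab, hzero]
  rw [ae_iff]
  refine measure_mono_null ?_ hnull
  intro s hs
  simp only [mem_ofPred_eq, not_forall] at hs
  obtain ⟨x, hx, hns⟩ := hs
  exact ⟨(x, s), ⟨hx, hns⟩, rfl⟩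
end

section
/- Let a, b be n×n complex matrices, let E, f : ℝ → ℝ be continuous, and let T > 0. Suppose U : ℝ × ℝ → Matrix (Fin n) (Fin n) ℂ is continuously differentiable (jointly in (ε,t)) and satisfies, for every ε ∈ ℝ: U(ε,0) = 1, U(ε,t) is invertible for all t, and for every t, the map t ↦ U(ε,t) has derivative (a + (E t + ε·f t) • b) * U(ε,t) at t (i.e. it solves the Schrödinger equation with control field E + ε·f). Then the first variation of the end-point is given by: the map ε ↦ U(ε,T) has derivative at ε = 0 equal to U(0,T) * ∫_{t=0}^{T} f t • ((U(0,t))⁻¹ * b * U(0,t)) dt. -/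
open Matrix intervalIntegral

attribute [local instance] Matrix.normedAddCommGroup Matrix.normedSpace

/-- The slope criterion for matrix-valued curves, stated with the topology instance of `Matrix`
rather than the one induced by the entrywise norm. -/
theorem hasDerivAt_matrix_iff_tendsto_slope {n : ℕ} {A : ℝ → Matrix (Fin n) (Fin n) ℂ}
    {A' : Matrix (Fin n) (Fin n) ℂ} {t : ℝ} :
    HasDerivAt A A' t ↔ Filter.Tendsto (slope A t) (nhdsWithin t {t}ᶜ) (nhds A') :=
  hasDerivAt_iff_tendsto_slope

theorem hasDerivAt_matrix_mul {n : ℕ} {A B : ℝ → Matrix (Fin n) (Fin n) ℂ}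
    {A' B' : Matrix (Fin n) (Fin n) ℂ} {t : ℝ}
    (hA : HasDerivAt A A' t) (hB : HasDerivAt B B' t) :
    HasDerivAt (fun s => A s * B s) (A' * B t + A t * B') t := by
  have hcont : Filter.Tendsto B (nhdsWithin t {t}ᶜ) (nhds (B t)) :=
    hB.continuousAt.tendsto.mono_left nhdsWithin_le_nhds
  rw [hasDerivAt_matrix_iff_tendsto_slope] at *
  refine ((hA.mul hcont).add (hB.const_mul (A t))).congr fun s => ?_
  simp only [slope_def_module, smul_mul_assoc, mul_smul_comm, ← smul_add]
  congr 1
  noncomm_ring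

theorem continuous_matrix_inv {X : Type*} [TopologicalSpace X] {n : ℕ}
    {A : X → Matrix (Fin n) (Fin n) ℂ} (hA : Continuous A) (hinv : ∀ x, IsUnit (A x)) :
    Continuous fun x => (A x)⁻¹ := by
  simp only [Matrix.inv_def, Ring.inverse_eq_inv']
  exact (hA.matrix_det.inv₀ fun x => ((Matrix.isUnit_iff_isUnit_det _).1 (hinv x)).ne_zero).smul
    hA.matrix_adjugate

theorem hasDerivAt_matrix_inv {n : ℕ} {A : ℝ → Matrix (Fin n) (Fin n) ℂ}
    {A' : Matrix (Fin n) (Fin n) ℂ} {t : ℝ} (hcont : Continuous A)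
    (hA : HasDerivAt A A' t) (hinv : ∀ s, IsUnit (A s)) :
    HasDerivAt (fun s => (A s)⁻¹) (-((A t)⁻¹ * A' * (A t)⁻¹)) t := by
  have hc : Filter.Tendsto (fun s => (A s)⁻¹) (nhdsWithin t {t}ᶜ) (nhds (A t)⁻¹) :=
    (continuous_matrix_inv hcont hinv).continuousAt.tendsto.mono_left nhdsWithin_le_nhds
  rw [hasDerivAt_matrix_iff_tendsto_slope] at *
  refine ((hc.mul hA).mul_const (A t)⁻¹).neg.congr fun s => ?_
  have hs := Matrix.nonsing_inv_mul (A s) ((Matrix.isUnit_iff_isUnit_det _).1 (hinv s))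
  have ht := Matrix.mul_nonsing_inv (A t) ((Matrix.isUnit_iff_isUnit_det _).1 (hinv t))
  simp only [slope_def_module, smul_mul_assoc, mul_smul_comm, ← smul_neg]
  congr 1
  rw [mul_sub, sub_mul, hs, mul_assoc, ht, one_mul, mul_one, neg_sub]

/-- First variation of the end-point map: if `U (ε, ·)` is the propagator of the
Schrödinger equation `dU/dt = (a + (E t + ε f t) • b) U` with `U (ε, 0) = 1`, then
`ε ↦ U (ε, T)` has derivative `U (0,T) * ∫₀ᵀ f t • (U (0,t)⁻¹ * b * U (0,t)) dt`
at `ε = 0`. -/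
theorem endpoint_first_variation
    (n : ℕ) (a b : Matrix (Fin n) (Fin n) ℂ) (E f : ℝ → ℝ)
    (hE : Continuous E) (hf : Continuous f) (T : ℝ) (hT : 0 < T)
    (U : ℝ × ℝ → Matrix (Fin n) (Fin n) ℂ)
    (hC1 : ContDiff ℝ 1 U)
    (hU0 : ∀ ε : ℝ, U (ε, 0) = 1)
    (hinv : ∀ ε t : ℝ, IsUnit (U (ε, t)))
    (hode : ∀ ε t : ℝ, HasDerivAt (fun t => U (ε, t))
      ((a + (E t + ε * f t) • b) * U (ε, t)) t) :
    HasDerivAt (fun ε => U (ε, T))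
      (U (0, T) * ∫ t in (0:ℝ)..T, f t • ((U (0, t))⁻¹ * b * U (0, t))) 0 := by
  have hU : Continuous U := hC1.continuous
  have hUt : Continuous fun t => U (0, t) := hU.comp (by fun_prop)
  have hV : Continuous fun t => (U (0, t))⁻¹ := continuous_matrix_inv hUt (hinv 0)
  have hker : Continuous (Function.uncurry fun ε t : ℝ =>
      f t • ((U (0, t))⁻¹ * b * U (ε, t))) :=
    (hf.comp continuous_snd).smul (((hV.comp continuous_snd).mul continuous_const).mul hU)
  have hG : Continuous fun ε : ℝ => ∫ t in (0:ℝ)..T, f t • ((U (0, t))⁻¹ * b * U (ε, t)) :=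
    intervalIntegral.continuous_parametric_intervalIntegral_of_continuous' hker 0 T
  have hmul : ∀ t, U (0, t) * (U (0, t))⁻¹ = 1 := fun t =>
    Matrix.mul_nonsing_inv _ ((Matrix.isUnit_iff_isUnit_det _).1 (hinv 0 t))
  have hduhamel : ∀ ε : ℝ, U (ε, T) - U (0, T) =
      ε • (U (0, T) * ∫ t in (0:ℝ)..T, f t • ((U (0, t))⁻¹ * b * U (ε, t))) := by
    intro ε
    have hderiv : ∀ t, HasDerivAt (fun t => (U (0, t))⁻¹ * U (ε, t))
        (ε • f t • ((U (0, t))⁻¹ * b * U (ε, t))) t := by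
      intro t
      convert hasDerivAt_matrix_mul
        (hasDerivAt_matrix_inv hUt (hode 0 t) (hinv 0)) (hode ε t) using 1
      have h : (U (0, t))⁻¹ * ((a + (E t + 0 * f t) • b) * U (0, t)) * (U (0, t))⁻¹ =
          (U (0, t))⁻¹ * (a + (E t + 0 * f t) • b) := by
        rw [mul_assoc, mul_assoc, hmul, mul_one]
      rw [h]
      simp only [zero_mul, add_zero, add_smul, mul_smul, mul_add, add_mul, neg_mul,
        mul_smul_comm, smul_mul_assoc, mul_assoc, neg_add]
      abel
    have hint := intervalIntegral.integral_eq_sub_of_hasDerivAt (a := 0) (b := T)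
      (fun t _ => hderiv t)
      (((hker.comp (Continuous.prodMk_right ε)).const_smul ε).intervalIntegrable 0 T)
    rw [intervalIntegral.integral_smul, hU0, hU0, inv_one, one_mul] at hint
    rw [← mul_smul_comm, hint, mul_sub, ← mul_assoc, hmul, one_mul, mul_one]
  rw [hasDerivAt_matrix_iff_tendsto_slope]
  refine ((continuous_const.mul hG).continuousAt.tendsto.mono_left nhdsWithin_le_nhds).congr' ?_
  filter_upwards [self_mem_nhdsWithin] with ε hε
  rw [slope_def_module, hduhamel, sub_zero, inv_smul_smul₀ hε, Pi.mul_apply]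
end

section
/- Let a, b, B be n×n complex matrices, E : ℝ → ℝ continuous, T > 0, and let U : ℝ → Matrix (Fin n) (Fin n) ℂ satisfy U 0 = 1, U t invertible for all t, and HasDerivAt U ((a + E t • b) * U t) t for all t (U solves the Schrödinger equation dU/dt = (a + E(t)·b)·U, U(0) = 1). If Tr(Bᴴ * ((U t)⁻¹ * b * U t)) = 0 for all t ∈ [0,T] (the singular-control condition K(b_t, B) = 0), then also Tr(Bᴴ * ((U t)⁻¹ * (b*a − a*b) * U t)) = 0 for all t ∈ [0,T]. -/
open Matrix

attribute [local instance] Matrix.normedAddCommGroup Matrix.normedSpace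

/-- Derivative of the adjoint transport `U⁻¹ b U` along a solution of `dU/dt = c U`. -/
theorem HasDerivAt.ringInverse_mul_mul {R : Type*} [NormedRing R] [NormedAlgebra ℝ R]
    [HasSummableGeomSeries R] {U : ℝ → R} {c : R} {t : ℝ} (b : R) (hinv : IsUnit (U t))
    (hU : HasDerivAt U (c * U t) t) :
    HasDerivAt (fun s => Ring.inverse (U s) * b * U s)
      (Ring.inverse (U t) * (b * c - c * b) * U t) t := by
  obtain ⟨u, hu⟩ := hinv
  have hI := hasFDerivAt_ringInverse (𝕜 := ℝ) u
  rw [hu] at hI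
  refine (((hI.comp_hasDerivAt t hU).mul_const b).mul hU).congr_deriv ?_
  simp only [Function.comp_apply, ← hu, Ring.inverse_unit, _root_.neg_apply,
    ContinuousLinearMap.mulLeftRight_apply, mul_assoc, Units.mul_inv_cancel_left, neg_mul]
  noncomm_ring

/-- Derivative of the adjoint transport of a matrix along a solution of `dU/dt = c U`. -/
theorem Matrix.hasDerivAt_inv_mul_mul {n : ℕ} {U : ℝ → Matrix (Fin n) (Fin n) ℂ}
    {c : Matrix (Fin n) (Fin n) ℂ} {t : ℝ} (b : Matrix (Fin n) (Fin n) ℂ)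
    (hinv : IsUnit (U t)) (hU : HasDerivAt U (c * U t) t) :
    HasDerivAt (fun s => (U s)⁻¹ * b * U s) ((U t)⁻¹ * (b * c - c * b) * U t) t := by
  simp only [Matrix.nonsing_inv_eq_ringInverse]
  let R : NormedRing (Matrix (Fin n) (Fin n) ℂ) := Matrix.linftyOpNormedRing
  let _ : NormedAlgebra ℝ (Matrix (Fin n) (Fin n) ℂ) := Matrix.linftyOpNormedAlgebra
  have _ : @CompleteSpace _ R.toMetricSpace.toUniformSpace :=
    inferInstanceAs (CompleteSpace (Fin n → Fin n → ℂ))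
  exact HasDerivAt.ringInverse_mul_mul b hinv hU

/-- A function vanishing on a nondegenerate closed interval has zero derivative there. -/
theorem HasDerivAt.eq_zero_of_forall_mem_Icc {F : Type*} [NormedAddCommGroup F]
    [NormedSpace ℝ F] {f : ℝ → F} {f' : F} {x y t : ℝ} (hxy : x < y) (ht : t ∈ Set.Icc x y)
    (hf : HasDerivAt f f' t) (h0 : ∀ s ∈ Set.Icc x y, f s = 0) : f' = 0 :=
  (uniqueDiffOn_Icc hxy t ht).eq_deriv _ hf.hasDerivWithinAt
    ((hasDerivWithinAt_const t _ (0 : F)).congr h0 (h0 t ht))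

/-- Differentiating the singular-control condition: if `U` solves the Schrödinger
equation `dU/dt = (a + E t • b) U`, `U 0 = 1`, and the Killing-form pairing
`Tr(Bᴴ (U t)⁻¹ b (U t))` vanishes on `[0, T]`, then so does
`Tr(Bᴴ (U t)⁻¹ [b,a] (U t))`. -/
theorem singular_control_first_derivative_condition
    (n : ℕ) (a b B : Matrix (Fin n) (Fin n) ℂ) (E : ℝ → ℝ) (hE : Continuous E)
    (T : ℝ) (hT : 0 < T)
    (U : ℝ → Matrix (Fin n) (Fin n) ℂ)
    (hU0 : U 0 = 1)
    (hinv : ∀ t : ℝ, IsUnit (U t))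
    (hode : ∀ t : ℝ, HasDerivAt U ((a + E t • b) * U t) t)
    (hsing : ∀ t ∈ Set.Icc (0:ℝ) T, (Bᴴ * ((U t)⁻¹ * b * U t)).trace = 0) :
    ∀ t ∈ Set.Icc (0:ℝ) T, (Bᴴ * ((U t)⁻¹ * (b * a - a * b) * U t)).trace = 0 := by
  intro t ht
  have hcomm : b * (a + E t • b) - (a + E t • b) * b = b * a - a * b := by
    rw [mul_add, add_mul, mul_smul_comm, smul_mul_assoc, add_sub_add_right_eq_sub]
  have hd := Matrix.hasDerivAt_inv_mul_mul b (hinv t) (hode t)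
  rw [hcomm] at hd
  let L : Matrix (Fin n) (Fin n) ℂ →L[ℝ] ℂ := LinearMap.toContinuousLinearMap
    (Matrix.traceLinearMap (Fin n) ℝ ℂ ∘ₗ LinearMap.mulLeft ℝ Bᴴ)
  exact (L.hasFDerivAt.comp_hasDerivAt t hd).eq_zero_of_forall_mem_Icc hT ht hsing
end

section
/- Let A be an n×n complex matrix (n ≥ 1) and let ad_A : Matrix (Fin n) (Fin n) ℂ →ₗ[ℂ] Matrix (Fin n) (Fin n) ℂ be the linear operator ad_A(X) = A*X − X*A. Then the spectrum of ad_A equals the set of differences of eigenvalues of A: spectrum ℂ ad_A = { λ − μ | λ ∈ spectrum ℂ A, μ ∈ spectrum ℂ A }. -/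
open Matrix

/-- An intertwining relation `a * x = x * b` extends to all polynomials in `a` and `b`. -/
theorem Polynomial.aeval_mul_eq_mul_aeval_of_mul_eq_mul {R S : Type*} [CommSemiring R]
    [Semiring S] [Algebra R S] {a b x : S} (h : a * x = x * b) (p : Polynomial R) :
    Polynomial.aeval a p * x = x * Polynomial.aeval b p := by
  induction p using Polynomial.induction_on' with
  | add p q hp hq => simp only [map_add, add_mul, mul_add, hp, hq]
  | monomial k r =>
    have hk : a ^ k * x = x * b ^ k :=
      ((show SemiconjBy x b a from h.symm).pow_right k).symm
    rw [Polynomial.aeval_monomial, Polynomial.aeval_monomial, mul_assoc, hk, ← mul_assoc,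
      Algebra.commutes, mul_assoc]

/-- If a nonzero matrix intertwines `A` and `B`, then `A` and `B` have a common eigenvalue. -/
theorem Matrix.exists_mem_spectrum_of_mul_eq_mul {m K : Type*} [Fintype m] [DecidableEq m]
    [Field K] [IsAlgClosed K] {A B X : Matrix m m K} (hX : X ≠ 0) (h : A * X = X * B) :
    ∃ r ∈ spectrum K A, r ∈ spectrum K B := by
  have h0 : X * Polynomial.aeval B A.charpoly = 0 := by
    rw [← Polynomial.aeval_mul_eq_mul_aeval_of_mul_eq_mul h, Matrix.aeval_self_charpoly, zero_mul]
  have hu : ¬ IsUnit (Polynomial.aeval B A.charpoly) := fun hu => hX (hu.mul_left_eq_zero.mp h0)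
  rw [(IsAlgClosed.splits A.charpoly).eq_prod_roots_of_monic A.charpoly_monic] at hu
  obtain ⟨r, hrB, hr⟩ := spectrum.exists_mem_of_not_isUnit_aeval_prod hu
  exact ⟨r, Matrix.mem_spectrum_iff_isRoot_charpoly.mpr hr, hrB⟩

/-- Every element of the spectrum of a matrix over a field has an eigenvector. -/
theorem Matrix.exists_mulVec_eq_smul_of_mem_spectrum {m K : Type*} [Fintype m] [DecidableEq m]
    [Field K] {A : Matrix m m K} {r : K} (hr : r ∈ spectrum K A) :
    ∃ v ≠ 0, A *ᵥ v = r • v := by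
  rw [← Matrix.spectrum_toLin', ← Module.End.hasEigenvalue_iff_mem_spectrum] at hr
  obtain ⟨v, hv⟩ := hr.exists_hasEigenvector
  exact ⟨v, hv.2, by simpa using hv.apply_eq_smul⟩

/-- The spectrum of the adjoint operator `ad_A : X ↦ A*X - X*A` on `n × n` complex
matrices is exactly the set of differences of eigenvalues of `A`. -/
theorem spectrum_ad_eq_differences
    (n : ℕ) (hn : 1 ≤ n) (A : Matrix (Fin n) (Fin n) ℂ)
    (adA : Module.End ℂ (Matrix (Fin n) (Fin n) ℂ))
    (hadA : ∀ X : Matrix (Fin n) (Fin n) ℂ, adA X = A * X - X * A) :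
    spectrum ℂ adA =
      {z : ℂ | ∃ lam ∈ spectrum ℂ A, ∃ mu ∈ spectrum ℂ A, z = lam - mu} := by
  ext z
  rw [← Module.End.hasEigenvalue_iff_mem_spectrum]
  constructor
  · intro hz
    obtain ⟨X, hX⟩ := hz.exists_hasEigenvector
    have hAX : A * X = X * (algebraMap ℂ _ z + A) := by
      have h := hX.apply_eq_smul
      rw [hadA, sub_eq_iff_eq_add] at h
      rw [h, mul_add, ← Algebra.commutes, Algebra.smul_def]
    obtain ⟨r, hrA, hr⟩ := Matrix.exists_mem_spectrum_of_mul_eq_mul hX.2 hAX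
    refine ⟨r, hrA, r - z, ?_, by ring⟩
    rw [← spectrum.add_mem_add_iff (s := z)]
    simpa [add_comm] using hr
  · rintro ⟨lam, hlam, mu, hmu, rfl⟩
    obtain ⟨v, hv0, hv⟩ := Matrix.exists_mulVec_eq_smul_of_mem_spectrum hlam
    have hmu' : mu ∈ spectrum ℂ Aᵀ := by
      rwa [Matrix.mem_spectrum_iff_isRoot_charpoly, Matrix.charpoly_transpose,
        ← Matrix.mem_spectrum_iff_isRoot_charpoly]
    obtain ⟨w, hw0, hw⟩ := Matrix.exists_mulVec_eq_smul_of_mem_spectrum hmu'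
    rw [Matrix.mulVec_transpose] at hw
    refine Module.End.hasEigenvalue_of_hasEigenvector (x := vecMulVec v w)
      ⟨Module.End.mem_eigenspace_iff.mpr ?_, ?_⟩
    · rw [hadA, Matrix.mul_vecMulVec, Matrix.vecMulVec_mul, hv, hw, Matrix.smul_vecMulVec,
        Matrix.vecMulVec_smul, sub_smul]
    · simp [Matrix.vecMulVec_eq_zero, hv0, hw0]
end

section
/- Let n ≥ 2 and let ψ ∈ (Fin n → ℂ) be a unit vector (Σ_i |ψ i|² = 1). Then the image of su(n) under the real-linear map X ↦ X.mulVec ψ equals the real hyperplane { v ∈ (Fin n → ℂ) | Re(Σ_i conj(ψ i) * v i) = 0 }. That is, { X.mulVec ψ | Xᴴ = −X and Tr X = 0 } = { v | Re ⟪ψ, v⟫ = 0 }, the tangent space to the unit sphere of ℂⁿ at ψ. -/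
open Matrix

/-- A skew-Hermitian form takes purely imaginary values on the diagonal. -/
theorem re_star_dotProduct_mulVec_eq_zero {ι : Type*} [Fintype ι] {X : Matrix ι ι ℂ}
    (hX : Xᴴ = -X) (ψ : ι → ℂ) : (star ψ ⬝ᵥ X *ᵥ ψ).re = 0 := by
  have h : star (star ψ ⬝ᵥ X *ᵥ ψ) = -(star ψ ⬝ᵥ X *ᵥ ψ) := by
    rw [← star_dotProduct, star_mulVec, hX, vecMul_neg,
      neg_dotProduct, ← dotProduct_mulVec]
  have h' := congrArg Complex.re h
  simp only [Complex.star_def, Complex.conj_re, Complex.neg_re] at h'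
  linarith

/-- If `⟪ψ, v⟫` is purely imaginary, some traceless skew-Hermitian matrix maps the unit vector
`ψ` to `v`. -/
theorem exists_traceless_skewHermitian_mulVec_eq {ι : Type*} [Fintype ι] [DecidableEq ι]
    (hι : 2 ≤ Fintype.card ι) {ψ v : ι → ℂ} (hψ : star ψ ⬝ᵥ ψ = 1)
    (hv : (star ψ ⬝ᵥ v).re = 0) :
    ∃ X : Matrix ι ι ℂ, Xᴴ = -X ∧ X.trace = 0 ∧ X *ᵥ ψ = v := by
  obtain ⟨s, hs⟩ : ∃ s, star ψ ⬝ᵥ v = s := ⟨_, rfl⟩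
  rw [hs] at hv
  have hstar : star s = -s := by
    apply Complex.ext <;> simp [hv]
  have hs' : star v ⬝ᵥ ψ = -s := by
    rw [star_dotProduct, hs, hstar]
  have hcard : (Fintype.card ι : ℂ) - 1 ≠ 0 := by
    rw [sub_ne_zero]
    exact_mod_cast (by omega : Fintype.card ι ≠ 1)
  obtain ⟨d, hd⟩ : ∃ d, -s / ((Fintype.card ι : ℂ) - 1) = d := ⟨_, rfl⟩
  have hdstar : star d = -d := by
    rw [← hd]
    simp only [star_div₀, star_neg, hstar, star_sub, star_natCast, star_one, neg_div]
  have hd' : d * ((Fintype.card ι : ℂ) - 1) = -s := by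
    rw [← hd, div_mul_cancel₀ _ hcard]
  refine ⟨vecMulVec v (star ψ) - vecMulVec ψ (star v) - s • vecMulVec ψ (star ψ)
    + d • (1 - vecMulVec ψ (star ψ)), ?_, ?_, ?_⟩
  · simp only [conjTranspose_add, conjTranspose_sub, conjTranspose_smul, conjTranspose_one,
      conjTranspose_vecMulVec, star_star, hstar, hdstar, neg_smul]
    abel
  · simp only [trace_add, trace_sub, trace_smul, trace_one, trace_vecMulVec, smul_eq_mul,
      dotProduct_comm _ (star _), hψ, hs, hs']
    linear_combination hd'
  · simp only [add_mulVec, sub_mulVec, smul_mulVec, one_mulVec, vecMulVec_mulVec, hψ, hs']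
    ext i
    simp

/-- Infinitesimal transitivity of `su(n)` on the unit sphere of `ℂⁿ`: for a unit vector
`ψ`, the image of `su(n)` (traceless skew-Hermitian matrices) under `X ↦ X.mulVec ψ` is
the real hyperplane `{v | Re ⟪ψ, v⟫ = 0}`, the tangent space to the unit sphere at `ψ`. -/
theorem su_action_image_eq_sphere_tangent
    (n : ℕ) (hn : 2 ≤ n) (ψ : Fin n → ℂ)
    (hψ : ∑ i, Complex.normSq (ψ i) = 1) :
    {v : Fin n → ℂ | ∃ X : Matrix (Fin n) (Fin n) ℂ,
        Xᴴ = -X ∧ X.trace = 0 ∧ X.mulVec ψ = v}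
      = {v : Fin n → ℂ | (∑ i, (starRingEnd ℂ) (ψ i) * v i).re = 0} := by
  ext v
  constructor
  · rintro ⟨X, hX, -, rfl⟩
    exact re_star_dotProduct_mulVec_eq_zero hX ψ
  · intro hv
    refine exists_traceless_skewHermitian_mulVec_eq (by simpa using hn) ?_ hv
    simp only [dotProduct, Pi.star_apply, Complex.star_def, ← Complex.normSq_eq_conj_mul_self]
    exact_mod_cast hψ
end

section
/- Let n ≥ 2, let U be an n×n complex unitary matrix, let ψ ∈ (Fin n → ℂ) be a unit vector, let E be a real vector space, and let L : E →ₗ[ℝ] Matrix (Fin n) (Fin n) ℂ be a real-linear map whose range contains the tangent space to SU(n) at U, i.e. { X * U | X ∈ su(n) } ⊆ Set.range L. Then the composed real-linear map e ↦ (L e).mulVec ψ has range containing the tangent space to the unit sphere of ℂⁿ at U.mulVec ψ: for every v ∈ (Fin n → ℂ) with Re ⟪U.mulVec ψ, v⟫ = 0 there exists e ∈ E with (L e).mulVec ψ = v. In particular, every control at which the end-point map for the propagator is nonsingular (locally surjective onto SU(n)) is also nonsingular for the control of the pure state ψ_T = U_T ψ. -/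
open Matrix

/-- `SU(n)` acts infinitesimally transitively on the unit sphere of `ℂⁿ` for `n ≥ 2`. -/
theorem exists_traceless_skewHermitian_mulVec_eq_s13 {n : ℕ} (hn : 2 ≤ n) (φ v : Fin n → ℂ)
    (hφ : star φ ⬝ᵥ φ = 1) (hv : (star φ ⬝ᵥ v).re = 0) :
    ∃ X : Matrix (Fin n) (Fin n) ℂ, Xᴴ = -X ∧ X.trace = 0 ∧ X *ᵥ φ = v := by
  obtain ⟨c, hc⟩ : ∃ c, star φ ⬝ᵥ v = c := ⟨_, rfl⟩
  have hcc : star c = -c := by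
    rw [hc] at hv
    apply Complex.ext <;> simp [hv]
  have hvφ : star v ⬝ᵥ φ = -c := by
    rw [← hcc, ← hc, star_dotProduct]
  have hn1 : (n : ℂ) - 1 ≠ 0 := by
    rw [sub_ne_zero]
    exact_mod_cast (by omega : n ≠ 1)
  have hcd : star (c / ((n : ℂ) - 1)) = -(c / ((n : ℂ) - 1)) := by
    rw [star_div₀, hcc, star_sub, star_natCast, star_one, neg_div]
  refine ⟨vecMulVec v (star φ) - vecMulVec φ (star v) - c • vecMulVec φ (star φ)
    - (c / ((n : ℂ) - 1)) • (1 - vecMulVec φ (star φ)), ?_, ?_, ?_⟩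
  · simp only [conjTranspose_sub, conjTranspose_smul, conjTranspose_vecMulVec, star_star,
      conjTranspose_one, hcc, hcd]
    module
  · simp only [trace_sub, trace_smul, trace_vecMulVec, trace_one, Fintype.card_fin,
      dotProduct_comm _ (star _), hφ, hc, hvφ, smul_eq_mul]
    field_simp
    ring
  · simp only [sub_mulVec, smul_mulVec, vecMulVec_mulVec, one_mulVec, hφ, hvφ,
      op_smul_eq_smul]
    module

/-- If a real-linear map `L` (the differential of the end-point map at a control) has
range containing the tangent space `{X * U | X ∈ su(n)}` of `SU(n)` at a unitary `U`,
then the composed map `e ↦ (L e).mulVec ψ` has range containing the tangent space to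
the unit sphere of `ℂⁿ` at `U.mulVec ψ`: every control nonsingular for the propagator
is nonsingular for the control of the pure state. -/
theorem propagator_nonsingular_implies_state_nonsingular
    (n : ℕ) (hn : 2 ≤ n) (U : Matrix (Fin n) (Fin n) ℂ) (hU : Uᴴ * U = 1)
    (ψ : Fin n → ℂ) (hψ : ∑ i, Complex.normSq (ψ i) = 1)
    (E : Type*) [AddCommGroup E] [Module ℝ E]
    (L : E →ₗ[ℝ] Matrix (Fin n) (Fin n) ℂ)
    (hrange : {M : Matrix (Fin n) (Fin n) ℂ | ∃ X : Matrix (Fin n) (Fin n) ℂ,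
        Xᴴ = -X ∧ X.trace = 0 ∧ M = X * U} ⊆ Set.range L) :
    ∀ v : Fin n → ℂ, (∑ i, (starRingEnd ℂ) (U.mulVec ψ i) * v i).re = 0 →
      ∃ e : E, (L e).mulVec ψ = v := by
  intro v hv
  have hφ : star (U *ᵥ ψ) ⬝ᵥ (U *ᵥ ψ) = 1 := by
    rw [star_mulVec, dotProduct_mulVec, vecMul_vecMul, hU, vecMul_one]
    simp only [dotProduct, Pi.star_apply, RCLike.star_def, ← Complex.normSq_eq_conj_mul_self]
    exact_mod_cast hψ
  obtain ⟨X, hX, hX0, hXv⟩ := exists_traceless_skewHermitian_mulVec_eq_s13 hn (U *ᵥ ψ) v hφ hv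
  obtain ⟨e, he⟩ := hrange ⟨X, hX, hX0, rfl⟩
  exact ⟨e, by rw [he, ← mulVec_mulVec, hXv]⟩
end
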